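/- arXiv:2603.25016 — 2 statements merged into one kernel-verified Lean document; each statement's English description precedes it below -/
import Mathlib

section
/- Let U ⊆ (Fin n → ℝ) be open, let K : U → ℂ be continuously differentiable with K(x) ≠ 0 for all x ∈ U, and let γ : [0,1] → U be a continuously differentiable loop with γ(0) = γ(1). Then the closed-loop integral of the logarithmic derivative of K is quantized: ∫₀¹ (fderiv K (γ t)) (γ'(t)) / K(γ t) dt ∈ 2πi ℤ. Equivalently, with the complex velocity η_μ = −i (ħ/m) (∂_μ K)/K, there exists an integer w such that (m/ħ) ∮_γ Σ_μ η_μ dx^μ = 2π w. -/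
open intervalIntegral

/-- If `f` is nonvanishing on `[a, b]` and differentiable on a neighbourhood of `[a, b]` with
continuous derivative, then the exponential of the integral of its logarithmic derivative is the
ratio of its endpoint values. -/
theorem exp_integral_logDeriv_mul {f f' : ℝ → ℂ} {a b : ℝ} (hab : a ≤ b) {V : Set ℝ}
    (hV : IsOpen V) (habV : Set.Icc a b ⊆ V) (hf : ∀ t ∈ V, HasDerivAt f (f' t) t)
    (hf' : ContinuousOn f' V) (hf0 : ∀ t ∈ V, f t ≠ 0) :
    Complex.exp (∫ t in a..b, f' t / f t) * f a = f b := by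
  have hg : ContinuousOn (fun t => f' t / f t) V :=
    hf'.div (fun t ht => (hf t ht).continuousAt.continuousWithinAt) hf0
  have hF : ∀ t ∈ Set.Icc a b,
      HasDerivAt (fun u => ∫ s in a..u, f' s / f s) (f' t / f t) t := fun t ht => by
    refine integral_hasDerivAt_right ?_ (hg.stronglyMeasurableAtFilter hV t (habV ht))
      (hg.continuousAt (hV.mem_nhds (habV ht)))
    refine (hg.mono ?_).intervalIntegrable
    rw [Set.uIcc_of_le ht.1]
    exact (Set.Icc_subset_Icc_right ht.2).trans habV
  have hderiv : ∀ t ∈ Set.Icc a b,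
      HasDerivAt (fun u => f u * Complex.exp (-∫ s in a..u, f' s / f s)) 0 t := fun t ht => by
    have h0 := hf0 t (habV ht)
    refine ((hf t (habV ht)).fun_mul (hF t ht).fun_neg.cexp).congr_deriv ?_
    field_simp
    ring
  have hconst := constant_of_has_deriv_right_zero
    (fun t ht => (hderiv t ht).continuousAt.continuousWithinAt)
    (fun t ht => (hderiv t (Set.Ico_subset_Icc_self ht)).hasDerivWithinAt)
    b (Set.right_mem_Icc.2 hab)
  simp only [integral_same, neg_zero, Complex.exp_zero, mul_one] at hconst
  rw [← hconst, mul_left_comm, ← Complex.exp_add, add_neg_cancel, Complex.exp_zero, mul_one]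

/-- A real-linear map to `ℂ` is determined by its values on the standard basis. -/
theorem ContinuousLinearMap.apply_eq_sum_single_mul {ι : Type*} [Fintype ι] [DecidableEq ι]
    (L : (ι → ℝ) →L[ℝ] ℂ) (v : ι → ℝ) :
    L v = ∑ μ, L (Pi.single μ 1) * (v μ : ℂ) := by
  conv_lhs => rw [pi_eq_sum_univ' v, map_sum]
  refine Finset.sum_congr rfl fun μ _ => ?_
  rw [map_smul, Complex.real_smul, mul_comm]

/- STATEMENT 7: holonomy quantization. For a C¹ nonvanishing K on an open set U and a C¹
loop γ in U, the closed-loop integral of the logarithmic derivative of K lies in 2πiℤ;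
equivalently, with η_μ = −i(hbar/m)(∂_μ K)/K, the line integral satisfies
(m/hbar) ∮_γ Σ_μ η_μ dx^μ = 2π w for some integer w. -/
theorem holonomy_quantization {n : ℕ} (m hbar : ℝ) (hm : 0 < m) (hq : 0 < hbar)
    (U : Set (Fin n → ℝ)) (hU : IsOpen U)
    (K : (Fin n → ℝ) → ℂ) (hK : ContDiffOn ℝ 1 K U) (hK0 : ∀ x ∈ U, K x ≠ 0)
    (γ : ℝ → (Fin n → ℝ)) (hγ : ContDiff ℝ 1 γ)
    (hγU : ∀ t ∈ Set.Icc (0 : ℝ) 1, γ t ∈ U) (hloop : γ 0 = γ 1) :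
    ∃ w : ℤ,
      (∫ t in (0 : ℝ)..1, fderiv ℝ K (γ t) (deriv γ t) / K (γ t)) =
        2 * (Real.pi : ℂ) * Complex.I * (w : ℂ) ∧
      ((m : ℂ) / (hbar : ℂ)) *
          (∫ t in (0 : ℝ)..1,
            ∑ μ, (-Complex.I * ((hbar : ℂ) / (m : ℂ)) *
                fderiv ℝ K (γ t) (Pi.single μ 1) / K (γ t)) * (deriv γ t μ : ℂ)) =
        2 * (Real.pi : ℂ) * (w : ℂ) := by
  have hV : IsOpen (γ ⁻¹' U) := hU.preimage hγ.continuous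
  have hf : ∀ t ∈ γ ⁻¹' U,
      HasDerivAt (fun t => K (γ t)) (fderiv ℝ K (γ t) (deriv γ t)) t := fun t ht =>
    ((hK.differentiableOn one_ne_zero).differentiableAt
      (hU.mem_nhds ht)).hasFDerivAt.comp_hasDerivAt t
      (hγ.differentiable one_ne_zero t).hasDerivAt
  have hf' : ContinuousOn (fun t => fderiv ℝ K (γ t) (deriv γ t)) (γ ⁻¹' U) :=
    ((hK.continuousOn_fderiv_of_isOpen hU le_rfl).comp hγ.continuous.continuousOn
      (Set.mapsTo_preimage γ U)).clm_apply (hγ.continuous_deriv le_rfl).continuousOn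
  have hexp := exp_integral_logDeriv_mul zero_le_one hV hγU hf hf' fun t ht => hK0 _ ht
  rw [← hloop, mul_eq_right₀ (hK0 _ (hγU 0 (by simp))), Complex.exp_eq_one_iff] at hexp
  obtain ⟨w, hw⟩ := hexp
  have hint : (∫ t in (0 : ℝ)..1, fderiv ℝ K (γ t) (deriv γ t) / K (γ t)) =
      2 * (Real.pi : ℂ) * Complex.I * (w : ℂ) := by
    rw [hw]
    ring
  refine ⟨w, hint, ?_⟩
  have hsum : ∀ t, ∑ μ, (-Complex.I * ((hbar : ℂ) / (m : ℂ)) *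
      fderiv ℝ K (γ t) (Pi.single μ 1) / K (γ t)) * (deriv γ t μ : ℂ) =
      (-Complex.I * ((hbar : ℂ) / (m : ℂ))) *
        (fderiv ℝ K (γ t) (deriv γ t) / K (γ t)) := fun t => by
    rw [(fderiv ℝ K (γ t)).apply_eq_sum_single_mul (deriv γ t), Finset.sum_div, Finset.mul_sum]
    exact Finset.sum_congr rfl fun μ _ => by ring
  simp_rw [hsum]
  rw [integral_const_mul, hint]
  have hm0 : (m : ℂ) ≠ 0 := by exact_mod_cast hm.ne'
  have hq0 : (hbar : ℂ) ≠ 0 := by exact_mod_cast hq.ne'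
  field_simp
  rw [Complex.I_sq]
  ring
end

section
/- Let U ⊆ (Fin n → ℝ) be an open, simply connected set, let K : U → ℂ be continuously differentiable with K(x) ≠ 0 for all x ∈ U, and let γ : [0,1] → U be a continuously differentiable loop with γ(0) = γ(1). Then the holonomy is trivial: ∫₀¹ (fderiv K (γ t)) (γ'(t)) / K(γ t) dt = 0, and hence exp( i (m/ħ) ∮_γ Σ_μ η_μ dx^μ ) = 1, where η_μ = −i (ħ/m) (∂_μ K)/K. In particular, non-trivial holonomy of the flat connection defined by η can only arise over a non-simply-connected domain. -/
open intervalIntegral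

section

open Set Filter Topology

/-- A continuous logarithm of a differentiable function is differentiable, and its derivative is
the logarithmic derivative. -/
theorem HasDerivAt.of_cexp_eventuallyEq {f k : ℝ → ℂ} {k' : ℂ} {t : ℝ} (hf : ContinuousAt f t)
    (hfk : ∀ᶠ s in 𝓝 t, Complex.exp (f s) = k s) (hk : HasDerivAt k k' t) :
    HasDerivAt f (k' / k t) t := by
  have hkt : k t ≠ 0 := hfk.self_of_nhds ▸ Complex.exp_ne_zero _
  have hlog : HasDerivAt (fun s ↦ Complex.log (k s / k t) + f t) (k' / k t) t := by
    have := (hk.div_const (k t)).clog_real (by simp [div_self hkt])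
    simpa [div_self hkt] using this.add_const (f t)
  refine hlog.congr_of_eventuallyEq ?_
  have him : ContinuousAt (fun s ↦ (f s - f t).im) t :=
    Complex.continuous_im.continuousAt.comp (hf.sub continuousAt_const)
  have hnear : ∀ᶠ s in 𝓝 t, (f s - f t).im ∈ Ioo (-Real.pi) Real.pi :=
    him.eventually_mem (Ioo_mem_nhds (by simp [Real.pi_pos]) (by simp [Real.pi_pos]))
  filter_upwards [hfk, hnear] with s hs hs'
  rw [← hs, ← hfk.self_of_nhds, ← Complex.exp_sub, Complex.log_exp hs'.1 hs'.2.le, sub_add_cancel]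

/-- A nonvanishing continuous function on an open simply connected subset of a locally path
connected space has a continuous logarithm. -/
theorem ContinuousOn.exists_cexp_eqOn {X : Type*} [TopologicalSpace X] [LocallyPathConnectedSpace X]
    {U : Set X} (hU : IsOpen U) [SimplyConnectedSpace U] {K : X → ℂ} (hK : ContinuousOn K U)
    (hK0 : ∀ x ∈ U, K x ≠ 0) :
    ∃ L : X → ℂ, ContinuousOn L U ∧ ∀ x ∈ U, Complex.exp (L x) = K x := by
  have := hU.locallyPathConnectedSpace
  obtain ⟨x₀⟩ : Nonempty U := PathConnectedSpace.nonempty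
  obtain ⟨F, ⟨-, hF⟩, -⟩ := Complex.isCoveringMapOn_exp.existsUnique_continuousMap_lifts
    ⟨U.domRestrict K, continuousOn_iff_continuous_domRestrict.mp hK⟩
    (Complex.exp_log (hK0 x₀ x₀.2)) (fun a ↦ hK0 a a.2)
  have hext : U.domRestrict (Function.extend Subtype.val F 0) = F :=
    funext fun x ↦ Subtype.val_injective.extend_apply F 0 x
  refine ⟨Function.extend Subtype.val F 0, ?_, fun x hx ↦ ?_⟩
  · rw [continuousOn_iff_continuous_domRestrict, hext]
    exact F.continuous
  · have h := congrFun hext ⟨x, hx⟩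
    simp only [domRestrict_apply] at h
    rw [h]
    exact congrFun hF ⟨x, hx⟩

/-- The logarithmic derivative of a nonvanishing `C¹` function on an open simply connected set
integrates to zero along every `C¹` loop. -/
theorem integral_fderiv_div_eq_zero_of_simplyConnected {E : Type*} [NormedAddCommGroup E]
    [NormedSpace ℝ E] {U : Set E} (hU : IsOpen U) [SimplyConnectedSpace U] {K : E → ℂ}
    (hK : ContDiffOn ℝ 1 K U) (hK0 : ∀ x ∈ U, K x ≠ 0) {γ : ℝ → E} (hγ : ContDiff ℝ 1 γ)
    {a b : ℝ} (hγU : ∀ t ∈ uIcc a b, γ t ∈ U) (hloop : γ a = γ b) :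
    ∫ t in a..b, fderiv ℝ K (γ t) (deriv γ t) / K (γ t) = 0 := by
  obtain ⟨L, hL, hLK⟩ := hK.continuousOn.exists_cexp_eqOn hU hK0
  have hderiv : ∀ t ∈ uIcc a b,
      HasDerivAt (L ∘ γ) (fderiv ℝ K (γ t) (deriv γ t) / K (γ t)) t := fun t ht ↦ by
    have hnhds : U ∈ 𝓝 (γ t) := hU.mem_nhds (hγU t ht)
    have hγt : HasDerivAt γ (deriv γ t) t := (hγ.differentiable one_ne_zero t).hasDerivAt
    have hKt : HasFDerivAt K (fderiv ℝ K (γ t)) (γ t) :=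
      ((hK.contDiffAt hnhds).differentiableAt one_ne_zero).hasFDerivAt
    refine HasDerivAt.of_cexp_eventuallyEq (k := K ∘ γ)
      ((hL.continuousAt hnhds).comp hγt.continuousAt) ?_ (hKt.comp_hasDerivAt t hγt)
    filter_upwards [hγt.continuousAt.eventually_mem hnhds] with s hs using hLK _ hs
  have hmaps : MapsTo γ (uIcc a b) U := hγU
  have hint : ContinuousOn (fun t ↦ fderiv ℝ K (γ t) (deriv γ t) / K (γ t)) (uIcc a b) :=
    (((hK.continuousOn_fderiv_of_isOpen hU le_rfl).comp hγ.continuous.continuousOn hmaps).clm_apply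
      (hγ.continuous_deriv le_rfl).continuousOn).div
      (hK.continuousOn.comp hγ.continuous.continuousOn hmaps) fun t ht ↦ hK0 _ (hγU t ht)
  rw [intervalIntegral.integral_eq_sub_of_hasDerivAt hderiv hint.intervalIntegrable]
  simp [hloop]

end

/- STATEMENT 8: trivial holonomy over a simply connected domain. For a C¹ nonvanishing K
on an open, simply connected set U and a C¹ loop γ in U, the closed-loop integral of the
logarithmic derivative of K vanishes, and hence the holonomy
exp( i (m/hbar) ∮_γ Σ_μ η_μ dx^μ ) = 1, with η_μ = −i(hbar/m)(∂_μ K)/K. -/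
theorem trivial_holonomy_simply_connected {n : ℕ} (m hbar : ℝ) (hm : 0 < m) (hq : 0 < hbar)
    (U : Set (Fin n → ℝ)) (hU : IsOpen U) (hsc : SimplyConnectedSpace U)
    (K : (Fin n → ℝ) → ℂ) (hK : ContDiffOn ℝ 1 K U) (hK0 : ∀ x ∈ U, K x ≠ 0)
    (γ : ℝ → (Fin n → ℝ)) (hγ : ContDiff ℝ 1 γ)
    (hγU : ∀ t ∈ Set.Icc (0 : ℝ) 1, γ t ∈ U) (hloop : γ 0 = γ 1) :
    (∫ t in (0 : ℝ)..1, fderiv ℝ K (γ t) (deriv γ t) / K (γ t)) = 0 ∧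
    Complex.exp (Complex.I * ((m : ℂ) / (hbar : ℂ)) *
        ∫ t in (0 : ℝ)..1,
          ∑ μ, (-Complex.I * ((hbar : ℂ) / (m : ℂ)) *
              fderiv ℝ K (γ t) (Pi.single μ 1) / K (γ t)) * (deriv γ t μ : ℂ)) = 1 := by
  have hzero := integral_fderiv_div_eq_zero_of_simplyConnected hU hK hK0 hγ
    (by simpa only [Set.uIcc_of_le zero_le_one] using hγU) hloop
  refine ⟨hzero, ?_⟩
  have hsum : ∀ t, ∑ μ, (-Complex.I * ((hbar : ℂ) / (m : ℂ)) *
      fderiv ℝ K (γ t) (Pi.single μ 1) / K (γ t)) * (deriv γ t μ : ℂ) =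
      (-Complex.I * ((hbar : ℂ) / (m : ℂ))) * (fderiv ℝ K (γ t) (deriv γ t) / K (γ t)) := by
    intro t
    conv_rhs => rw [pi_eq_sum_univ' (deriv γ t)]
    simp only [map_sum, map_smul, Complex.real_smul, Finset.sum_div, Finset.mul_sum]
    exact Finset.sum_congr rfl fun μ _ ↦ by ring
  simp only [hsum, intervalIntegral.integral_const_mul, hzero, mul_zero, Complex.exp_zero]
end
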